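/- arXiv:1405.1480 — 3 statements merged into one kernel-verified Lean document; each statement's English description precedes it below -/
import Mathlib

section
/- Let F, L ∈ ℝ^{n×n} with F symmetric positive definite and L symmetric positive semidefinite, and let A ∈ ℝ^{2n×2n} be the block matrix A = [[−F, L], [−L, 0]]. Then every complex eigenvalue λ of A has nonpositive real part. -/
open Matrix

/-- If the quadratic form of a real square matrix is nonpositive, then all its complex eigenvalues
have nonpositive real part. -/
theorem Matrix.re_nonpos_of_dotProduct_mulVec_nonpos {m : Type*} [Fintype m]
    {A : Matrix m m ℝ} (hA : ∀ x : m → ℝ, x ⬝ᵥ A *ᵥ x ≤ 0)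
    {lam : ℂ} {v : m → ℂ} (hv : v ≠ 0) (heig : A.map Complex.ofReal *ᵥ v = lam • v) :
    lam.re ≤ 0 := by
  set p : m → ℝ := fun i => (v i).re with hp
  set q : m → ℝ := fun i => (v i).im with hq
  have hAp : A *ᵥ p = lam.re • p - lam.im • q := by
    ext i
    simpa [mulVec, dotProduct, hp, hq] using congrArg Complex.re (congrFun heig i)
  have hAq : A *ᵥ q = lam.re • q + lam.im • p := by
    ext i
    simpa [mulVec, dotProduct, hp, hq] using congrArg Complex.im (congrFun heig i)
  have hsum : lam.re * (p ⬝ᵥ p + q ⬝ᵥ q) ≤ 0 := by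
    have h := add_nonpos (hA p) (hA q)
    simp only [hAp, hAq, dotProduct_sub, dotProduct_add, dotProduct_smul, smul_eq_mul,
      dotProduct_comm q p] at h
    linarith
  have hp0 : 0 ≤ p ⬝ᵥ p := dotProduct_self_star_nonneg p
  have hq0 : 0 ≤ q ⬝ᵥ q := dotProduct_self_star_nonneg q
  by_contra! hlam
  have hzero : p ⬝ᵥ p + q ⬝ᵥ q ≤ 0 := nonpos_of_mul_nonpos_right hsum hlam
  have hpz : p = 0 := dotProduct_self_eq_zero.mp (by linarith)
  have hqz : q = 0 := dotProduct_self_eq_zero.mp (by linarith)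
  exact hv (funext fun i => Complex.ext (congrFun hpz i) (congrFun hqz i))

/-- The quadratic form of `[[−F, L], [−L, 0]]` with `L` symmetric only sees the block `−F`. -/
theorem Matrix.dotProduct_fromBlocks_neg_mulVec {m : Type*} [Fintype m]
    (F : Matrix m m ℝ) {L : Matrix m m ℝ} (hL : L.IsSymm) (x : m ⊕ m → ℝ) :
    x ⬝ᵥ fromBlocks (-F) L (-L) 0 *ᵥ x = -((x ∘ Sum.inl) ⬝ᵥ F *ᵥ (x ∘ Sum.inl)) := by
  have hswap : (x ∘ Sum.inl) ⬝ᵥ L *ᵥ (x ∘ Sum.inr) = (x ∘ Sum.inr) ⬝ᵥ L *ᵥ (x ∘ Sum.inl) := by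
    rw [dotProduct_mulVec, ← mulVec_transpose, hL.eq, dotProduct_comm]
  rw [fromBlocks_mulVec]
  nth_rewrite 1 [← Sum.elim_comp_inl_inr x]
  rw [sumElim_dotProduct_sumElim]
  simp only [neg_mulVec, zero_mulVec, dotProduct_add, dotProduct_neg, dotProduct_zero, hswap]
  ring

/-- Every complex eigenvalue of the block matrix `A = [[−F, L], [−L, 0]]`, with
`F` symmetric positive definite and `L` symmetric positive semidefinite, has
nonpositive real part. -/
theorem block_matrix_eigenvalues_nonpos_re {n : ℕ}
    (F L : Matrix (Fin n) (Fin n) ℝ) (hF : F.PosDef) (hL : L.PosSemidef)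
    (A : Matrix (Fin n ⊕ Fin n) (Fin n ⊕ Fin n) ℝ)
    (hA : A = Matrix.fromBlocks (-F) L (-L) 0)
    (lam : ℂ) (v : Fin n ⊕ Fin n → ℂ) (hv : v ≠ 0)
    (heig : A.map (Complex.ofReal) *ᵥ v = lam • v) :
    lam.re ≤ 0 := by
  subst hA
  refine re_nonpos_of_dotProduct_mulVec_nonpos (fun x => ?_) hv heig
  rw [dotProduct_fromBlocks_neg_mulVec F (by simpa using hL.isHermitian), neg_nonpos]
  simpa using hF.posSemidef.dotProduct_mulVec_nonneg (x ∘ Sum.inl)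
end

section
/- Let F, L ∈ ℝ^{n×n} with F symmetric positive definite and L symmetric positive semidefinite, and let A = [[−F, L], [−L, 0]] ∈ ℝ^{2n×2n}. If λ ∈ ℂ is an eigenvalue of A with Re(λ) = 0 and v = (δ, e) ∈ ℂ^{2n} is a corresponding eigenvector (δ, e ∈ ℂⁿ), then δ = 0, Le = 0 and λ = 0. -/
open Matrix

theorem Matrix.re_map_ofReal_mulVec {m n : Type*} [Fintype n] (M : Matrix m n ℝ) (x : n → ℂ)
    (i : m) : ((M.map Complex.ofReal *ᵥ x) i).re = (M *ᵥ fun j => (x j).re) i := by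
  simp [mulVec, dotProduct]

theorem Matrix.im_map_ofReal_mulVec {m n : Type*} [Fintype n] (M : Matrix m n ℝ) (x : n → ℂ)
    (i : m) : ((M.map Complex.ofReal *ᵥ x) i).im = (M *ᵥ fun j => (x j).im) i := by
  simp [mulVec, dotProduct]

/-- Energy identity: if `(a + i b, c + i d)` is an eigenvector of `[[−F, L], [−L, 0]]` for the
eigenvalue `i ω`, written out in real and imaginary parts, then `a = b = 0`. -/
theorem Matrix.PosDef.eq_zero_of_imaginary_eigenvector {n : Type*} [Fintype n]
    {F L : Matrix n n ℝ} (hF : F.PosDef) (hL : L.IsSymm) {a b c d : n → ℝ} {ω : ℝ}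
    (ha : F *ᵥ a = L *ᵥ c + ω • b) (hb : F *ᵥ b = L *ᵥ d - ω • a)
    (hc : L *ᵥ a = ω • d) (hd : L *ᵥ b = -(ω • c)) : a = 0 ∧ b = 0 := by
  have symm (x y : n → ℝ) : x ⬝ᵥ L *ᵥ y = L *ᵥ x ⬝ᵥ y := by
    rw [dotProduct_mulVec, ← mulVec_transpose, hL.eq]
  have energy : a ⬝ᵥ F *ᵥ a + b ⬝ᵥ F *ᵥ b = 0 := by
    rw [ha, hb, dotProduct_add, dotProduct_sub, symm, symm, hc, hd]
    simp only [smul_dotProduct, neg_dotProduct, dotProduct_smul, dotProduct_comm b a,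
      dotProduct_comm d c]
    ring
  have nonneg (x : n → ℝ) : 0 ≤ x ⬝ᵥ F *ᵥ x := by
    simpa using hF.posSemidef.dotProduct_mulVec_nonneg x
  have pos {x : n → ℝ} (hx : x ≠ 0) : 0 < x ⬝ᵥ F *ᵥ x := by
    simpa using hF.dotProduct_mulVec_pos hx
  constructor <;> by_contra h
  · linarith [pos h, nonneg b]
  · linarith [pos h, nonneg a]

/-- If `λ` is a purely imaginary eigenvalue of `A = [[−F, L], [−L, 0]]` with
eigenvector `(δ, e)`, where `F` is symmetric positive definite and `L` is
symmetric positive semidefinite, then `δ = 0`, `L e = 0` and `λ = 0`. -/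
theorem block_matrix_imaginary_eigenvalue {n : ℕ}
    (F L : Matrix (Fin n) (Fin n) ℝ) (hF : F.PosDef) (hL : L.PosSemidef)
    (A : Matrix (Fin n ⊕ Fin n) (Fin n ⊕ Fin n) ℝ)
    (hA : A = Matrix.fromBlocks (-F) L (-L) 0)
    (lam : ℂ) (hre : lam.re = 0)
    (δ e : Fin n → ℂ) (hv : Sum.elim δ e ≠ 0)
    (heig : A.map (Complex.ofReal) *ᵥ Sum.elim δ e = lam • Sum.elim δ e) :
    δ = 0 ∧ L.map (Complex.ofReal) *ᵥ e = 0 ∧ lam = 0 := by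
  subst hA
  have h₁ (i : Fin n) :
      -(F.map Complex.ofReal *ᵥ δ) i + (L.map Complex.ofReal *ᵥ e) i = lam * δ i := by
    simpa [fromBlocks_map, fromBlocks_mulVec, Matrix.map_neg, neg_mulVec]
      using congrFun heig (Sum.inl i)
  have h₂ (i : Fin n) : -(L.map Complex.ofReal *ᵥ δ) i = lam * e i := by
    simpa [fromBlocks_map, fromBlocks_mulVec, Matrix.map_neg, neg_mulVec]
      using congrFun heig (Sum.inr i)
  have hre₁ (i : Fin n) := congrArg Complex.re (h₁ i)
  have him₁ (i : Fin n) := congrArg Complex.im (h₁ i)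
  have hre₂ (i : Fin n) := congrArg Complex.re (h₂ i)
  have him₂ (i : Fin n) := congrArg Complex.im (h₂ i)
  simp only [Complex.add_re, Complex.add_im, Complex.neg_re, Complex.neg_im, Complex.mul_re,
    Complex.mul_im, hre, re_map_ofReal_mulVec, im_map_ofReal_mulVec] at hre₁ him₁ hre₂ him₂
  obtain ⟨ha, hb⟩ := hF.eq_zero_of_imaginary_eigenvector (L := L)
    (a := fun j => (δ j).re) (b := fun j => (δ j).im)
    (c := fun j => (e j).re) (d := fun j => (e j).im) (ω := lam.im)
    (by simpa using hL.isHermitian)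
    (by ext i; simp only [Pi.add_apply, Pi.smul_apply, smul_eq_mul]; linarith [hre₁ i])
    (by ext i; simp only [Pi.sub_apply, Pi.smul_apply, smul_eq_mul]; linarith [him₁ i])
    (by ext i; simp only [Pi.smul_apply, smul_eq_mul]; linarith [hre₂ i])
    (by ext i; simp only [Pi.neg_apply, Pi.smul_apply, smul_eq_mul]; linarith [him₂ i])
  have hδ : δ = 0 := funext fun i => Complex.ext (congrFun ha i) (congrFun hb i)
  subst hδ
  refine ⟨rfl, funext fun i => by simpa using h₁ i, ?_⟩
  by_contra hlam
  have he : e = 0 := funext fun i => by simpa [hlam] using h₂ i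
  exact hv (by simp [he])
end

section
/- Let G be a connected undirected simple graph on n vertices with Laplacian L = L(G), let K₁ be a nonnegative diagonal matrix with at least one positive diagonal entry, and set F = L + K₁. Suppose δ, e : ℝ → ℝⁿ are differentiable and satisfy δ̇(t) = −Fδ(t) + Le(t) and ė(t) = −Lδ(t) for all t ≥ 0. Then δ(t) → 0 as t → ∞, for all initial conditions δ(0), e(0). -/
open Matrix Filter

theorem antitoneOn_Ici_of_hasDerivAt_nonpos {f f' : ℝ → ℝ} {a : ℝ}
    (hf : ∀ t, a ≤ t → HasDerivAt f (f' t) t) (hf' : ∀ t, a ≤ t → f' t ≤ 0) :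
    AntitoneOn f (Set.Ici a) := by
  refine antitoneOn_of_hasDerivWithinAt_nonpos (f' := f') (convex_Ici a)
    (fun t ht => (hf t ht).continuousAt.continuousWithinAt) ?_ ?_
  · exact fun t ht => (hf t (interior_subset ht)).hasDerivWithinAt
  · exact fun t ht => hf' t (interior_subset ht)

theorem AntitoneOn.exists_tendsto_atTop {f : ℝ → ℝ} {a b : ℝ}
    (hf : AntitoneOn f (Set.Ici a)) (hb : ∀ t, a ≤ t → b ≤ f t) :
    ∃ l, Tendsto f atTop (nhds l) := by
  have hanti : Antitone fun t => f (max t a) := fun s t hst =>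
    hf (le_max_right s a) (le_max_right t a) (max_le_max_right a hst)
  refine ⟨_, (tendsto_atTop_ciInf hanti ⟨b, ?_⟩).congr' ?_⟩
  · rintro _ ⟨t, rfl⟩
    exact hb _ (le_max_right t a)
  · filter_upwards [eventually_ge_atTop a] with t ht
    rw [max_eq_left ht]

/-- If `V ≥ 0` decreases at rate `q ≥ 0` and the derivative of `q` is bounded above,
then `q` tends to zero. -/
theorem tendsto_zero_of_dissipation {V q q' : ℝ → ℝ} {C : ℝ}
    (hV : ∀ t, 0 ≤ t → HasDerivAt V (-q t) t) (hq : ∀ t, 0 ≤ t → HasDerivAt q (q' t) t)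
    (hV0 : ∀ t, 0 ≤ V t) (hq0 : ∀ t, 0 ≤ q t) (hC0 : 0 ≤ C) (hC : ∀ t, 0 ≤ t → q' t ≤ C) :
    Tendsto q atTop (nhds 0) := by
  obtain ⟨v, hv⟩ := (antitoneOn_Ici_of_hasDerivAt_nonpos hV
    fun t _ => neg_nonpos.2 (hq0 t)).exists_tendsto_atTop (b := 0) fun t _ => hV0 t
  have hW : AntitoneOn (fun t => q t ^ 2 + 2 * C * V t) (Set.Ici 0) := by
    refine antitoneOn_Ici_of_hasDerivAt_nonpos
      (fun t ht => ((hq t ht).pow 2).add ((hV t ht).const_mul (2 * C))) fun t ht => ?_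
    have := mul_le_mul_of_nonneg_left (hC t ht) (hq0 t)
    norm_num
    linarith
  obtain ⟨w, hw⟩ := hW.exists_tendsto_atTop (b := 0) fun t _ =>
    add_nonneg (sq_nonneg _) (mul_nonneg (by positivity) (hV0 t))
  have hlim : Tendsto q atTop (nhds √(w - 2 * C * v)) := by
    refine (Real.continuous_sqrt.tendsto _).comp (hw.sub (hv.const_mul (2 * C))) |>.congr ?_
    intro t
    simp [Real.sqrt_sq (hq0 t)]
  rcases (Real.sqrt_nonneg (w - 2 * C * v)).eq_or_lt with h | h
  · rwa [← h] at hlim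
  exfalso
  generalize √(w - 2 * C * v) = m at h hlim
  obtain ⟨T, hT⟩ := ((hlim.eventually (eventually_ge_nhds (half_lt_self h))).and
    (eventually_ge_atTop 0)).exists_forall_of_atTop
  have hT0 : 0 ≤ T := (hT T le_rfl).2
  have hanti : AntitoneOn (fun t => V t + m / 2 * t) (Set.Ici T) := by
    refine antitoneOn_Ici_of_hasDerivAt_nonpos
      (fun t ht => (hV t (hT0.trans ht)).add ((hasDerivAt_id t).const_mul (m / 2)))
      fun t ht => ?_
    have := (hT t ht).1
    linarith
  have hs : 0 ≤ 2 * (V T + 1) / m := by have := hV0 T; positivity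
  have hle := hanti (Set.mem_Ici.2 le_rfl) (Set.mem_Ici.2 (le_add_of_nonneg_right hs))
    (le_add_of_nonneg_right hs)
  have hcancel : m / 2 * (2 * (V T + 1) / m) = V T + 1 := by field_simp
  have := hV0 (T + 2 * (V T + 1) / m)
  beta_reduce at hle
  rw [mul_add (m / 2), hcancel] at hle
  linarith

theorem HasDerivAt.dotProduct {n : Type*} [Fintype n] {u v : ℝ → n → ℝ} {u' v' : n → ℝ} {t : ℝ}
    (hu : HasDerivAt u u' t) (hv : HasDerivAt v v' t) :
    HasDerivAt (fun s => u s ⬝ᵥ v s) (u' ⬝ᵥ v t + u t ⬝ᵥ v') t := by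
  simp only [_root_.dotProduct, ← Finset.sum_add_distrib]
  exact HasDerivAt.fun_sum fun i _ => (hasDerivAt_pi.1 hu i).mul (hasDerivAt_pi.1 hv i)

theorem HasDerivAt.mulVec {m n : Type*} [Fintype m] [Fintype n] (A : Matrix m n ℝ)
    {u : ℝ → n → ℝ} {u' : n → ℝ} {t : ℝ} (hu : HasDerivAt u u' t) :
    HasDerivAt (fun s => A *ᵥ u s) (A *ᵥ u') t :=
  hasDerivAt_pi.2 fun i => by
    simpa [Matrix.mulVec] using (hasDerivAt_const t (A i)).dotProduct hu

theorem Matrix.IsSymm.dotProduct_mulVec_comm {n : Type*} [Fintype n] {A : Matrix n n ℝ}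
    (hA : A.IsSymm) (x y : n → ℝ) : x ⬝ᵥ A *ᵥ y = y ⬝ᵥ A *ᵥ x := by
  rw [dotProduct_mulVec, ← mulVec_transpose, hA.eq, dotProduct_comm]

theorem norm_le_sqrt_dotProduct_self {n : Type*} [Fintype n] (x : n → ℝ) :
    ‖x‖ ≤ √(x ⬝ᵥ x) := by
  refine (pi_norm_le_iff_of_nonneg (Real.sqrt_nonneg _)).2 fun i => Real.abs_le_sqrt ?_
  rw [sq]
  exact Finset.single_le_sum (f := fun j => x j * x j)
    (fun j _ => mul_self_nonneg _) (Finset.mem_univ i)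

theorem dotProduct_diagonal_mulVec_self {n : Type*} [Fintype n] [DecidableEq n]
    (k x : n → ℝ) : x ⬝ᵥ diagonal k *ᵥ x = ∑ i, k i * x i ^ 2 := by
  simp only [dotProduct, mulVec_diagonal]
  exact Finset.sum_congr rfl fun i _ => by ring

namespace SimpleGraph

variable {V : Type*} [Fintype V] [DecidableEq V] (G : SimpleGraph V) [DecidableRel G.Adj]

theorem dotProduct_lapMatrix_mulVec_self (x : V → ℝ) :
    x ⬝ᵥ G.lapMatrix ℝ *ᵥ x = (∑ i, ∑ j, if G.Adj i j then (x i - x j) ^ 2 else 0) / 2 := by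
  rw [← G.lapMatrix_toLinearMap₂' ℝ x, Matrix.toLinearMap₂'_apply']

theorem dotProduct_lapMatrix_mulVec_self_nonneg (x : V → ℝ) :
    0 ≤ x ⬝ᵥ G.lapMatrix ℝ *ᵥ x := by
  rw [dotProduct_lapMatrix_mulVec_self]
  positivity

theorem sq_sub_le_two_mul_lapMatrix {i j : V} (hij : G.Adj i j) (x : V → ℝ) :
    (x i - x j) ^ 2 ≤ 2 * (x ⬝ᵥ G.lapMatrix ℝ *ᵥ x) := by
  rw [dotProduct_lapMatrix_mulVec_self, mul_div_cancel₀ _ two_ne_zero]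
  calc (x i - x j) ^ 2 = if G.Adj i j then (x i - x j) ^ 2 else 0 := (if_pos hij).symm
    _ ≤ ∑ b, if G.Adj i b then (x i - x b) ^ 2 else 0 :=
      Finset.single_le_sum (f := fun b => if G.Adj i b then (x i - x b) ^ 2 else 0)
        (fun b _ => by positivity) (Finset.mem_univ j)
    _ ≤ _ := Finset.single_le_sum (f := fun a => ∑ b, if G.Adj a b then (x a - x b) ^ 2 else 0)
        (fun a _ => by positivity) (Finset.mem_univ i)

/-- On a connected graph, convergence to zero of the quadratic form of the Laplacian plus a
nonnegative, nonzero diagonal matrix forces convergence to zero of its argument. -/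
theorem Connected.tendsto_zero_of_lapMatrix_add_diagonal {G : SimpleGraph V}
    [DecidableRel G.Adj] (hG : G.Connected) {k : V → ℝ} (hk : ∀ i, 0 ≤ k i)
    (hkpos : ∃ i, 0 < k i) {α : Type*} {l : Filter α} {x : α → V → ℝ}
    (hx : Tendsto (fun a => x a ⬝ᵥ (G.lapMatrix ℝ + diagonal k) *ᵥ x a) l (nhds 0)) :
    Tendsto x l (nhds 0) := by
  have of_sq_le {f : α → ℝ} {c : ℝ}
      (h : ∀ a, f a ^ 2 ≤ c * (x a ⬝ᵥ (G.lapMatrix ℝ + diagonal k) *ᵥ x a)) :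
      Tendsto f l (nhds 0) := by
    refine squeeze_zero_norm (fun a => Real.abs_le_sqrt (h a)) ?_
    simpa using (hx.const_mul c).sqrt
  have hdiag (a : α) : 0 ≤ x a ⬝ᵥ diagonal k *ᵥ x a := by
    rw [dotProduct_diagonal_mulVec_self]
    exact Finset.sum_nonneg fun i _ => mul_nonneg (hk i) (sq_nonneg _)
  obtain ⟨i, hi⟩ := hkpos
  have hbase : Tendsto (fun a => x a i) l (nhds 0) := by
    refine of_sq_le (c := (k i)⁻¹) fun a => ?_
    rw [← div_eq_inv_mul, le_div_iff₀ hi, add_mulVec, dotProduct_add, mul_comm]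
    refine le_add_of_nonneg_of_le (G.dotProduct_lapMatrix_mulVec_self_nonneg _) ?_
    rw [dotProduct_diagonal_mulVec_self]
    exact Finset.single_le_sum (f := fun j => k j * x a j ^ 2)
      (fun j _ => mul_nonneg (hk j) (sq_nonneg _)) (Finset.mem_univ i)
  refine tendsto_pi_nhds.2 fun j => ?_
  obtain ⟨p⟩ := hG.preconnected j i
  induction p with
  | nil => exact hbase
  | @cons u v w huv _ ih =>
    have hdiff : Tendsto (fun a => x a u - x a v) l (nhds 0) := by
      refine of_sq_le (c := 2) fun a => ?_
      rw [add_mulVec, dotProduct_add]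
      linarith [G.sq_sub_le_two_mul_lapMatrix huv (x a), hdiag a]
    simpa using hdiff.add (ih hi hbase)

end SimpleGraph

/-- For the error dynamics `δ̇ = −Fδ + Le`, `ė = −Lδ` with `L` the Laplacian of
a connected graph, `K₁` nonnegative diagonal with at least one positive entry,
and `F = L + K₁`, the error `δ(t)` vanishes asymptotically for every solution. -/
theorem error_state_tendsto_zero {n : ℕ} (G : SimpleGraph (Fin n))
    [DecidableRel G.Adj] (hG : G.Connected)
    (L : Matrix (Fin n) (Fin n) ℝ) (hL : L = G.lapMatrix ℝ)
    (k : Fin n → ℝ) (hk : ∀ i, 0 ≤ k i) (hkpos : ∃ i, 0 < k i)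
    (F : Matrix (Fin n) (Fin n) ℝ) (hF : F = L + Matrix.diagonal k)
    (δ e : ℝ → Fin n → ℝ)
    (hδ : ∀ t : ℝ, 0 ≤ t → HasDerivAt δ (-(F *ᵥ δ t) + L *ᵥ e t) t)
    (he : ∀ t : ℝ, 0 ≤ t → HasDerivAt e (-(L *ᵥ δ t)) t) :
    Tendsto δ atTop (nhds 0) := by
  have hLsymm : L.IsSymm := hL ▸ G.isSymm_lapMatrix ℝ
  have hq0 (t : ℝ) : 0 ≤ δ t ⬝ᵥ F *ᵥ δ t := by
    rw [hF, hL, add_mulVec, dotProduct_add, dotProduct_diagonal_mulVec_self]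
    exact add_nonneg (G.dotProduct_lapMatrix_mulVec_self_nonneg _)
      (Finset.sum_nonneg fun i _ => mul_nonneg (hk i) (sq_nonneg _))
  have hself (x : Fin n → ℝ) : 0 ≤ x ⬝ᵥ x := Finset.sum_nonneg fun i _ => mul_self_nonneg _
  set V : ℝ → ℝ := fun t => (δ t ⬝ᵥ δ t + e t ⬝ᵥ e t) / 2 with hVdef
  have hV (t : ℝ) (ht : 0 ≤ t) : HasDerivAt V (-(δ t ⬝ᵥ F *ᵥ δ t)) t := by
    refine ((((hδ t ht).dotProduct (hδ t ht)).add
      ((he t ht).dotProduct (he t ht))).div_const 2).congr_deriv ?_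
    rw [dotProduct_comm _ (δ t), dotProduct_comm _ (e t), dotProduct_add, dotProduct_neg,
      dotProduct_neg, hLsymm.dotProduct_mulVec_comm (e t)]
    ring
  have hV0 (t : ℝ) : 0 ≤ V t := div_nonneg (add_nonneg (hself _) (hself _)) zero_le_two
  have hVanti := antitoneOn_Ici_of_hasDerivAt_nonpos hV fun t _ => neg_nonpos.2 (hq0 t)
  let q' : (Fin n → ℝ) × (Fin n → ℝ) → ℝ := fun p =>
    (-(F *ᵥ p.1) + L *ᵥ p.2) ⬝ᵥ F *ᵥ p.1 + p.1 ⬝ᵥ F *ᵥ (-(F *ᵥ p.1) + L *ᵥ p.2)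
  have hq'cont : Continuous q' := by fun_prop
  obtain ⟨C, hC⟩ := (isCompact_closedBall (0 : (Fin n → ℝ) × (Fin n → ℝ))
    √(2 * V 0)).exists_bound_of_continuousOn hq'cont.continuousOn
  have hbound (t : ℝ) (ht : 0 ≤ t) : ‖q' (δ t, e t)‖ ≤ C := by
    refine hC _ (mem_closedBall_zero_iff.2 (max_le ?_ ?_)) <;>
    refine (norm_le_sqrt_dotProduct_self _).trans (Real.sqrt_le_sqrt ?_) <;>
    · have hle := hVanti (Set.mem_Ici.2 le_rfl) (Set.mem_Ici.2 ht) ht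
      have hδ0 := hself (δ t)
      have he0 := hself (e t)
      simp only [hVdef] at hle ⊢
      linarith
  have hq : Tendsto (fun t => δ t ⬝ᵥ F *ᵥ δ t) atTop (nhds 0) :=
    tendsto_zero_of_dissipation hV (q' := fun t => q' (δ t, e t))
      (fun t ht => (hδ t ht).dotProduct ((hδ t ht).mulVec F)) hV0 hq0
      ((norm_nonneg _).trans (hbound 0 le_rfl))
      fun t ht => (le_abs_self _).trans (hbound t ht)
  subst hF hL
  exact hG.tendsto_zero_of_lapMatrix_add_diagonal hk hkpos hq
end
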